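/- Let G be a connected simple graph on n vertices with maximum degree at most d, and let S ⊆ V be nonempty. For the projected Markov chain M_S on S and any positive integer h, the expected length of an h-hop walk in M_S whose starting state is uniformly distributed on S equals h·n/|S|. -/

import Mathlib

open scoped Classical

noncomputable section

/-- Transition matrix of the lazy random walk on `G` with step probability `1/(2d)`. -/
def lazyStep {V : Type*} [Fintype V] [DecidableEq V] (G : SimpleGraph V) [DecidableRel G.Adj]
    (d : ℕ) : Matrix V V ℝ :=
  Matrix.of fun u v =>
    if G.Adj u v then 1 / (2 * d)
    else if u = v then 1 - (G.degree u : ℝ) / (2 * d)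
    else 0

/-- `walkDist G d t s v` is the probability that the `t`-step lazy random walk from `s` ends
at `v`. -/
def walkDist {V : Type*} [Fintype V] [DecidableEq V] (G : SimpleGraph V) [DecidableRel G.Adj]
    (d t : ℕ) (s : V) : V → ℝ :=
  fun v => (lazyStep G d ^ t) s v

/-- The probability of a particular trajectory `w` of `t` steps of the lazy random walk. -/
def walkProb {V : Type*} [Fintype V] [DecidableEq V] (G : SimpleGraph V) [DecidableRel G.Adj]
    (d t : ℕ) (w : Fin (t + 1) → V) : ℝ :=
  ∏ i : Fin t, lazyStep G d (w i.castSucc) (w i.succ)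

/-- `projTrans G d S t u v`: the probability of the length-`t` transition from `u` to `v` in
the Markov chain projected onto `S`, i.e. the total probability of `t`-step lazy walks in `G`
from `u` to `v` whose intermediate vertices all lie outside `S`. -/
def projTrans {V : Type*} [Fintype V] [DecidableEq V] (G : SimpleGraph V) [DecidableRel G.Adj]
    (d : ℕ) (S : Finset V) (t : ℕ) (u v : V) : ℝ :=
  ∑ w : Fin (t + 1) → V,
    if w 0 = u ∧ w (Fin.last t) = v ∧
        (∀ i : Fin (t + 1), i ≠ 0 → i ≠ Fin.last t → w i ∉ S) then
      walkProb G d t w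
    else 0

/-- The expected total length of an `h`-hop walk in the projected chain `M_S` whose starting
state is uniform on `S`. -/
def expHopLength {V : Type*} [Fintype V] [DecidableEq V] (G : SimpleGraph V)
    [DecidableRel G.Adj] (d : ℕ) (S : Finset V) (h : ℕ) : ℝ :=
  ∑' ts : Fin h → ℕ,
    ∑ states : Fin (h + 1) → V,
      if (∀ i, states i ∈ S) ∧ (∀ i : Fin h, 1 ≤ ts i) then
        (1 / (S.card : ℝ)) *
          (∏ i : Fin h, projTrans G d S (ts i) (states i.castSucc) (states i.succ)) *
          (∑ i : Fin h, (ts i : ℝ))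
      else 0

open Filter Topology Matrix

section PathSum

variable {V : Type*} [Fintype V]

/-- The sum over all sequences of `h + 1` states of the product of an initial weight, the
transition weights and a final weight. -/
def pathSum {h : ℕ} (x y : V → ℝ) (M : Fin h → Matrix V V ℝ) : ℝ :=
  ∑ s : Fin (h + 1) → V,
    x (s 0) * (∏ j : Fin h, M j (s j.castSucc) (s j.succ)) * y (s (Fin.last h))

theorem pathSum_zero (x y : V → ℝ) (M : Fin 0 → Matrix V V ℝ) : pathSum x y M = x ⬝ᵥ y := by
  rw [pathSum, ← (Equiv.funUnique (Fin 1) V).symm.sum_comp]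
  simp [dotProduct, Equiv.funUnique]

theorem pathSum_succ {h : ℕ} (x y : V → ℝ) (M : Fin (h + 1) → Matrix V V ℝ) :
    pathSum x y M = pathSum (x ᵥ* M 0) y (fun j => M j.succ) := by
  rw [pathSum, ← (Fin.consEquiv fun _ => V).sum_comp, Fintype.sum_prod_type,
    Finset.sum_comm, pathSum]
  refine Finset.sum_congr rfl fun s _ => ?_
  simp only [vecMul, dotProduct, Finset.sum_mul]
  refine Finset.sum_congr rfl fun u _ => ?_
  simp only [Fin.consEquiv_apply, Fin.cons_zero, Fin.prod_univ_succ, Fin.castSucc_zero,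
    Fin.cons_succ, ← Fin.succ_castSucc, ← Fin.succ_last]
  ring

theorem pathSum_const [DecidableEq V] {h : ℕ} (x y : V → ℝ) (M : Matrix V V ℝ) :
    pathSum x y (fun _ : Fin h => M) = x ⬝ᵥ (M ^ h *ᵥ y) := by
  induction h generalizing x with
  | zero => simp [pathSum_zero]
  | succ h ih => rw [pathSum_succ, ih, pow_succ', ← mulVec_mulVec, dotProduct_mulVec x M]

theorem pathSum_eq_of_fixed {h : ℕ} (x y : V → ℝ) (M : Fin h → Matrix V V ℝ)
    (hM : ∀ j, M j *ᵥ y = y) : pathSum x y M = x ⬝ᵥ y := by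
  induction h generalizing x with
  | zero => exact pathSum_zero x y M
  | succ h ih => rw [pathSum_succ, ih _ _ fun j => hM j.succ, ← dotProduct_mulVec, hM]

theorem pathSum_single_exception {h : ℕ} (x y : V → ℝ) (K L : Matrix V V ℝ)
    (hx : x ᵥ* K = x) (hy : K *ᵥ y = y) (i : Fin h) :
    pathSum x y (fun j => if i = j then L else K) = x ⬝ᵥ (L *ᵥ y) := by
  induction h with
  | zero => exact i.elim0
  | succ h ih =>
    rw [pathSum_succ]
    cases i using Fin.cases with
    | zero =>
      rw [pathSum_eq_of_fixed _ _ _ fun j => by simpa [(Fin.succ_ne_zero j).symm] using hy]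
      simp [dotProduct_mulVec]
    | succ i => simpa [Fin.succ_inj, hx] using ih i

end PathSum

theorem hasSum_fin_prod {h : ℕ} (φ : Fin h → ℕ → ℝ) (a : Fin h → ℝ) (hφ : ∀ j t, 0 ≤ φ j t)
    (hsum : ∀ j, HasSum (φ j) (a j)) :
    HasSum (fun ts : Fin h → ℕ => ∏ j, φ j (ts j)) (∏ j, a j) := by
  induction h with
  | zero => simp
  | succ h ih =>
    have htail := ih (fun j => φ j.succ) (fun j => a j.succ) (fun j => hφ j.succ)
      (fun j => hsum j.succ)
    rw [← (Fin.consEquiv fun _ => ℕ).hasSum_iff, Fin.prod_univ_succ]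
    have hsummable : Summable fun p : ℕ × (Fin h → ℕ) => φ 0 p.1 * ∏ j : Fin h, φ j.succ (p.2 j) :=
      Summable.mul_of_nonneg (f := φ 0) (g := fun ts : Fin h → ℕ => ∏ j : Fin h, φ j.succ (ts j))
        (hsum 0).summable htail.summable (hφ 0)
        fun ts => Finset.prod_nonneg fun j _ => hφ _ _
    have hmul := HasSum.mul (hsum 0) htail hsummable
    simpa [Function.comp_def, Fin.prod_univ_succ, Fin.consEquiv_apply] using hmul

/-- For a convex sequence tending to zero, the second differences weighted by `t + 1` sum to the
initial term. -/
theorem hasSum_succ_mul_second_difference (c : ℕ → ℝ) (hc : Tendsto c atTop (𝓝 0))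
    (hconv : ∀ t, 0 ≤ c t - c (t + 1) - (c (t + 1) - c (t + 2))) :
    HasSum (fun t : ℕ => ((t : ℝ) + 1) * (c t - c (t + 1) - (c (t + 1) - c (t + 2)))) (c 0) := by
  set g : ℕ → ℝ := fun t => c t - c (t + 1) with hg
  have hanti : Antitone g := antitone_nat_of_succ_le fun t => by
    have := hconv t
    simp only [hg]; linarith
  have hglim : Tendsto g atTop (𝓝 0) := by
    simpa using hc.sub (hc.comp (tendsto_add_atTop_nat 1))
  have hgnn (t) : 0 ≤ g t := hanti.le_of_tendsto hglim t
  have hcanti : Antitone c := antitone_nat_of_succ_le fun t => by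
    have := hgnn t
    simp only [hg] at this; linarith
  have hcnn (t) : 0 ≤ c t := hcanti.le_of_tendsto hc t
  have hblock (k t : ℕ) : k * g (t + k) ≤ c t - c (t + k) := by
    induction k with
    | zero => simp
    | succ k ih =>
      have h1 : g (t + (k + 1)) ≤ g (t + k) := hanti (by omega)
      have h2 : g (t + k) = c (t + k) - c (t + (k + 1)) := rfl
      have h3 : (k : ℝ) * g (t + (k + 1)) ≤ k * g (t + k) := by gcongr
      push_cast
      linarith
  have hbound (T : ℕ) : T * g T ≤ 2 * c (T / 2) := by
    have h1 := hblock (T - T / 2) (T / 2)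
    rw [Nat.add_sub_cancel' (Nat.div_le_self T 2)] at h1
    have h2 : (T : ℝ) ≤ 2 * ((T - T / 2 : ℕ) : ℝ) := by
      exact_mod_cast (by omega : T ≤ 2 * (T - T / 2))
    have h3 := mul_le_mul_of_nonneg_right h2 (hgnn T)
    have h4 := hcnn T
    linarith
  have htg : Tendsto (fun T : ℕ => T * g T) atTop (𝓝 0) := by
    refine squeeze_zero (fun T => mul_nonneg T.cast_nonneg (hgnn T)) hbound ?_
    simpa using (hc.comp (Nat.tendsto_div_const_atTop two_ne_zero)).const_mul 2
  rw [hasSum_iff_tendsto_nat_of_nonneg fun t => mul_nonneg (by positivity) (hconv t)]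
  have hpartial (T : ℕ) :
      ∑ t ∈ Finset.range T, ((t : ℝ) + 1) * (c t - c (t + 1) - (c (t + 1) - c (t + 2))) =
        c 0 - c T - T * g T := by
    induction T with
    | zero => simp
    | succ T ih =>
      rw [Finset.sum_range_succ, ih]
      simp only [hg]
      push_cast
      ring
  simp only [hpartial]
  simpa using (tendsto_const_nhds.sub hc).sub htg

section Projected

variable {V : Type*} [DecidableEq V]

/-- The matrix `P` with the rows indexed by `S` replaced by zero. -/
def killedStep (S : Finset V) (P : Matrix V V ℝ) : Matrix V V ℝ :=
  Matrix.of fun u v => if u ∈ S then 0 else P u v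

/-- The indicator vector of `S`. -/
def indicatorVec (S : Finset V) : V → ℝ := fun u => if u ∈ S then 1 else 0

variable {S : Finset V} {P : Matrix V V ℝ}

theorem killedStep_nonneg (hP : ∀ u v, 0 ≤ P u v) (u v : V) : 0 ≤ killedStep S P u v := by
  simp only [killedStep, of_apply]
  split_ifs
  exacts [le_rfl, hP u v]

theorem indicatorVec_nonneg (u : V) : 0 ≤ indicatorVec S u := by
  simp only [indicatorVec]; split_ifs <;> norm_num

variable [Fintype V]

/-- The probability that the first `t` positions (from time `0`) of the walk from `u` avoid `S`. -/
def survival (S : Finset V) (P : Matrix V V ℝ) (t : ℕ) : V → ℝ :=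
  killedStep S P ^ t *ᵥ 1

/-- The weight of a transition of length `t` of the projected chain, extended by zero. -/
def hopMatrix (S : Finset V) (P : Matrix V V ℝ) (t : ℕ) : Matrix V V ℝ :=
  Matrix.of fun u v =>
    if u ∈ S ∧ v ∈ S ∧ 1 ≤ t then (P * killedStep S P ^ (t - 1)) u v else 0

theorem killedStep_mulVec (x : V → ℝ) (u : V) :
    (killedStep S P *ᵥ x) u = if u ∈ S then 0 else (P *ᵥ x) u := by
  by_cases hu : u ∈ S <;> simp [killedStep, mulVec, dotProduct, hu]

theorem survival_zero : survival S P 0 = 1 := by simp [survival]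

theorem survival_succ (t : ℕ) : survival S P (t + 1) = killedStep S P *ᵥ survival S P t := by
  rw [survival, survival, pow_succ', mulVec_mulVec]

theorem pow_entry_nonneg {A : Matrix V V ℝ} (hA : ∀ u v, 0 ≤ A u v) (t : ℕ) (u v : V) :
    0 ≤ (A ^ t) u v := by
  induction t generalizing v with
  | zero => simp only [pow_zero, one_apply]; split_ifs <;> norm_num
  | succ t ih =>
    rw [pow_succ, mul_apply]
    exact Finset.sum_nonneg fun w _ => mul_nonneg (ih w) (hA w v)

theorem hopMatrix_nonneg (hP : ∀ u v, 0 ≤ P u v) (t : ℕ) (u v : V) :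
    0 ≤ hopMatrix S P t u v := by
  simp only [hopMatrix, of_apply]
  split_ifs
  · rw [mul_apply]
    exact Finset.sum_nonneg fun w _ =>
      mul_nonneg (hP u w) (pow_entry_nonneg (killedStep_nonneg hP) _ _ _)
  · exact le_rfl

theorem hopMatrix_zero : hopMatrix S P 0 = 0 := by
  ext u v; simp [hopMatrix]

theorem survival_nonneg (hP : ∀ u v, 0 ≤ P u v) (t : ℕ) (u : V) : 0 ≤ survival S P t u := by
  rw [survival]
  exact Finset.sum_nonneg fun v _ =>
    mul_nonneg (pow_entry_nonneg (killedStep_nonneg hP) t u v) (by simp)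

theorem survival_antitone (hP : ∀ u v, 0 ≤ P u v) (hrow : P *ᵥ 1 = 1) :
    Antitone (survival S P) := by
  refine antitone_nat_of_succ_le fun t => ?_
  induction t with
  | zero =>
    intro u
    rw [survival_succ, survival_zero, killedStep_mulVec, hrow]
    split_ifs <;> simp
  | succ t ih =>
    intro u
    rw [survival_succ (t + 1), survival_succ t]
    exact Finset.sum_le_sum fun v _ =>
      mul_le_mul_of_nonneg_left (by simpa only [← survival_succ] using ih v)
        (killedStep_nonneg hP u v)

/-- If `h` is invariant under the killed step of an irreducible walk, then `h ≤ 0`. -/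
theorem killedStep_fixed_nonpos {G : SimpleGraph V} (hconn : G.Connected) (hS : S.Nonempty)
    (hP : ∀ u v, 0 ≤ P u v) (hrow : P *ᵥ 1 = 1) (hadj : ∀ u v, G.Adj u v → 0 < P u v)
    (f : V → ℝ) (hf : killedStep S P *ᵥ f = f) (v : V) : f v ≤ 0 := by
  obtain ⟨s, hs⟩ := hS
  obtain ⟨m, -, hm⟩ := Finset.exists_max_image Finset.univ f ⟨v, Finset.mem_univ v⟩
  by_contra! hv
  have hmpos : 0 < f m := hv.trans_le (hm v (Finset.mem_univ v))
  have hstep (u w : V) (hu : f u = f m) (huw : G.Adj u w) : f w = f m := by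
    have huS : u ∉ S := fun huS => by
      have := congrFun hf u
      rw [killedStep_mulVec, if_pos huS] at this
      linarith
    have hfu := congrFun hf u
    rw [killedStep_mulVec, if_neg huS] at hfu
    have hone := congrFun hrow u
    simp only [mulVec, dotProduct, Pi.one_apply, mul_one] at hfu hone
    have hzero : ∑ z, P u z * (f m - f z) = 0 := by
      simp only [mul_sub, Finset.sum_sub_distrib, ← Finset.sum_mul, hone, hfu, hu]
      ring
    have hnn : ∀ z ∈ Finset.univ, 0 ≤ P u z * (f m - f z) := fun z hz =>
      mul_nonneg (hP u z) (sub_nonneg.2 (hm z hz))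
    have := (Finset.sum_eq_zero_iff_of_nonneg hnn).1 hzero w (Finset.mem_univ w)
    rcases mul_eq_zero.1 this with h0 | h0
    · exact absurd h0 (hadj u w huw).ne'
    · linarith
  have hwalk (u w : V) (p : G.Walk u w) (hu : f u = f m) : f w = f m := by
    induction p with
    | nil => exact hu
    | cons h p ih => exact ih (hstep _ _ hu h)
  obtain ⟨p⟩ := hconn.preconnected m s
  have hfs := congrFun hf s
  rw [killedStep_mulVec, if_pos hs, hwalk m s p rfl] at hfs
  linarith

theorem survival_tendsto_zero {G : SimpleGraph V} (hconn : G.Connected) (hS : S.Nonempty)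
    (hP : ∀ u v, 0 ≤ P u v) (hrow : P *ᵥ 1 = 1) (hadj : ∀ u v, G.Adj u v → 0 < P u v) :
    Tendsto (survival S P) atTop (𝓝 0) := by
  have hlim (u : V) : Tendsto (fun t => survival S P t u) atTop (𝓝 (⨅ t, survival S P t u)) :=
    tendsto_atTop_ciInf (fun _ _ hst => survival_antitone hP hrow hst u)
      ⟨0, by rintro _ ⟨t, rfl⟩; exact survival_nonneg hP t u⟩
  set f : V → ℝ := fun u => ⨅ t, survival S P t u
  have hf : Tendsto (survival S P) atTop (𝓝 f) := tendsto_pi_nhds.2 hlim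
  have hfix : killedStep S P *ᵥ f = f := by
    have hcont : Continuous fun x : V → ℝ => killedStep S P *ᵥ x := by fun_prop
    refine tendsto_nhds_unique ((hcont.tendsto f).comp hf) ?_
    simpa only [Function.comp_def, ← survival_succ] using hf.comp (tendsto_add_atTop_nat 1)
  have hfz : f = 0 := funext fun u => le_antisymm
    (killedStep_fixed_nonpos hconn hS hP hrow hadj f hfix u)
    (le_ciInf fun t => survival_nonneg hP t u)
  rwa [hfz] at hf

theorem hopMatrix_symm (hsymm : Pᵀ = P) (t : ℕ) : (hopMatrix S P t)ᵀ = hopMatrix S P t := by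
  have hkill : killedStep S P = diagonal (fun u => if u ∈ S then 0 else 1) * P := by
    ext u v
    by_cases hu : u ∈ S <;> simp [killedStep, diagonal_mul, hu]
  have hpow (n : ℕ) : (P * killedStep S P ^ n)ᵀ = P * killedStep S P ^ n := by
    induction n with
    | zero => simpa using hsymm
    | succ n ih =>
      conv_lhs => rw [pow_succ, ← mul_assoc, transpose_mul, ih]
      rw [hkill, transpose_mul, hsymm, diagonal_transpose, pow_succ']
      simp only [mul_assoc]
  ext u v
  have := congrFun (congrFun (hpow (t - 1)) u) v
  simp only [transpose_apply] at this
  simp only [transpose_apply, hopMatrix, of_apply, this]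
  refine if_congr ?_ rfl rfl
  tauto

theorem hopMatrix_succ_mulVec_indicator (hrow : P *ᵥ 1 = 1) (t : ℕ) (u : V) :
    (hopMatrix S P (t + 1) *ᵥ indicatorVec S) u =
      if u ∈ S then (P *ᵥ survival S P t) u - (P *ᵥ survival S P (t + 1)) u else 0 := by
  have hind : indicatorVec S = 1 - killedStep S P *ᵥ 1 := by
    ext v
    rw [Pi.sub_apply, killedStep_mulVec, hrow]
    by_cases hv : v ∈ S <;> simp [indicatorVec, hv]
  by_cases hu : u ∈ S
  · have heq : (hopMatrix S P (t + 1) *ᵥ indicatorVec S) u =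
        ((P * killedStep S P ^ t) *ᵥ indicatorVec S) u := by
      refine Finset.sum_congr rfl fun v _ => ?_
      by_cases hv : v ∈ S <;> simp [hopMatrix, indicatorVec, hu, hv]
    rw [heq, hind, mulVec_sub, if_pos hu, Pi.sub_apply, survival, survival, pow_succ]
    simp only [mulVec_mulVec, mul_assoc]
  · rw [if_neg hu]
    simp [hopMatrix, mulVec, dotProduct, hu]

/-- The total transition matrix of the projected chain. -/
def hopTotal (S : Finset V) (P : Matrix V V ℝ) : Matrix V V ℝ :=
  Matrix.of fun u v => ∑' t, hopMatrix S P t u v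

/-- The matrix of first moments of the transition lengths of the projected chain. -/
def hopMoment (S : Finset V) (P : Matrix V V ℝ) : Matrix V V ℝ :=
  Matrix.of fun u v => ∑' t : ℕ, (t : ℝ) * hopMatrix S P t u v

theorem hopMatrix_mul_indicator (t : ℕ) (u v : V) :
    hopMatrix S P t u v * indicatorVec S v = hopMatrix S P t u v := by
  by_cases hv : v ∈ S <;> simp [hopMatrix, indicatorVec, hv]

theorem indicator_mul_hopMatrix (t : ℕ) (u v : V) :
    indicatorVec S u * hopMatrix S P t u v = hopMatrix S P t u v := by
  by_cases hu : u ∈ S <;> simp [hopMatrix, indicatorVec, hu]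

theorem hasSum_hopMatrix_mulVec_indicator (hP : ∀ u v, 0 ≤ P u v) (hrow : P *ᵥ 1 = 1)
    (hlim : Tendsto (survival S P) atTop (𝓝 0)) (u : V) :
    HasSum (fun t => (hopMatrix S P t *ᵥ indicatorVec S) u) (indicatorVec S u) := by
  have hnn (t) : 0 ≤ (hopMatrix S P t *ᵥ indicatorVec S) u :=
    Finset.sum_nonneg fun v _ => mul_nonneg (hopMatrix_nonneg hP t u v) (indicatorVec_nonneg v)
  rw [← hasSum_nat_add_iff' 1]
  simp only [Finset.range_one, Finset.sum_singleton, hopMatrix_zero, zero_mulVec, Pi.zero_apply,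
    sub_zero]
  rw [hasSum_iff_tendsto_nat_of_nonneg fun t => hnn (t + 1)]
  simp only [hopMatrix_succ_mulVec_indicator hrow]
  by_cases hu : u ∈ S
  · simp only [hu, if_true, indicatorVec,
      Finset.sum_range_sub' fun t => (P *ᵥ survival S P t) u]
    have hcont : Continuous fun x : V → ℝ => (P *ᵥ x) u := by fun_prop
    have := (hcont.tendsto 0).comp hlim
    simpa [survival_zero, hrow] using this.const_sub 1
  · simp [hu, indicatorVec]

theorem summable_hopMatrix (hP : ∀ u v, 0 ≤ P u v) (hrow : P *ᵥ 1 = 1)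
    (hlim : Tendsto (survival S P) atTop (𝓝 0)) (u v : V) :
    Summable fun t => hopMatrix S P t u v := by
  refine Summable.of_nonneg_of_le (fun t => hopMatrix_nonneg hP t u v) (fun t => ?_)
    (hasSum_hopMatrix_mulVec_indicator hP hrow hlim u).summable
  simp only [mulVec, dotProduct, hopMatrix_mul_indicator]
  exact Finset.single_le_sum (fun w _ => hopMatrix_nonneg hP t u w) (Finset.mem_univ v)

theorem hopTotal_mulVec_indicator (hP : ∀ u v, 0 ≤ P u v) (hrow : P *ᵥ 1 = 1)
    (hlim : Tendsto (survival S P) atTop (𝓝 0)) :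
    hopTotal S P *ᵥ indicatorVec S = indicatorVec S := by
  ext u
  refine HasSum.unique ?_ (hasSum_hopMatrix_mulVec_indicator hP hrow hlim u)
  exact hasSum_sum fun v _ => (summable_hopMatrix hP hrow hlim u v).hasSum.mul_right _

theorem indicator_vecMul_hopTotal (hP : ∀ u v, 0 ≤ P u v) (hrow : P *ᵥ 1 = 1)
    (hsymm : Pᵀ = P) (hlim : Tendsto (survival S P) atTop (𝓝 0)) :
    indicatorVec S ᵥ* hopTotal S P = indicatorVec S := by
  have : (hopTotal S P)ᵀ = hopTotal S P := by
    ext u v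
    simp only [hopTotal, transpose_apply, of_apply]
    exact tsum_congr fun t => congrFun (congrFun (hopMatrix_symm hsymm t) u) v
  rw [← mulVec_transpose, this, hopTotal_mulVec_indicator hP hrow hlim]

/-- Kac's formula: the mean return times to `S`, summed over `S`, give the number of states. -/
theorem hasSum_mul_indicator_hopMatrix_indicator (hP : ∀ u v, 0 ≤ P u v) (hrow : P *ᵥ 1 = 1)
    (hsymm : Pᵀ = P) (hlim : Tendsto (survival S P) atTop (𝓝 0)) :
    HasSum (fun t : ℕ => (t : ℝ) * (indicatorVec S ⬝ᵥ (hopMatrix S P t *ᵥ indicatorVec S)))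
      (Fintype.card V) := by
  set c : ℕ → ℝ := fun t => ∑ u, survival S P t u with hcdef
  have hdiff (t : ℕ) : ∑ u, (if u ∈ S then (P *ᵥ survival S P t) u else 0) = c t - c (t + 1) := by
    have hinv : ∑ u, (P *ᵥ survival S P t) u = c t := by
      have h1 : (1 : V → ℝ) ⬝ᵥ (P *ᵥ survival S P t) = 1 ⬝ᵥ survival S P t := by
        rw [dotProduct_mulVec, ← mulVec_transpose, hsymm, hrow]
      simpa [one_dotProduct] using h1
    rw [← hinv, hcdef]
    simp only [survival_succ, killedStep_mulVec, ← Finset.sum_sub_distrib]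
    refine Finset.sum_congr rfl fun u _ => ?_
    split_ifs <;> simp
  have hsecond (t : ℕ) : indicatorVec S ⬝ᵥ (hopMatrix S P (t + 1) *ᵥ indicatorVec S) =
      c t - c (t + 1) - (c (t + 1) - c (t + 2)) := by
    rw [← hdiff t, ← hdiff (t + 1), ← Finset.sum_sub_distrib]
    refine Finset.sum_congr rfl fun u _ => ?_
    rw [hopMatrix_succ_mulVec_indicator hrow]
    by_cases hu : u ∈ S <;> simp [indicatorVec, hu]
  have hc : Tendsto c atTop (𝓝 0) := by
    simpa using tendsto_finsetSum Finset.univ fun u _ => tendsto_pi_nhds.1 hlim u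
  have hnn (t : ℕ) : 0 ≤ c t - c (t + 1) - (c (t + 1) - c (t + 2)) := by
    rw [← hsecond]
    exact Finset.sum_nonneg fun u _ => mul_nonneg (indicatorVec_nonneg u) <|
      Finset.sum_nonneg fun v _ => mul_nonneg (hopMatrix_nonneg hP _ u v) (indicatorVec_nonneg v)
  rw [← hasSum_nat_add_iff' 1]
  have := hasSum_succ_mul_second_difference c hc hnn
  simpa [hsecond, hcdef, survival_zero] using this

theorem summable_mul_hopMatrix (hP : ∀ u v, 0 ≤ P u v) (hrow : P *ᵥ 1 = 1)
    (hsymm : Pᵀ = P) (hlim : Tendsto (survival S P) atTop (𝓝 0)) (u v : V) :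
    Summable fun t : ℕ => (t : ℝ) * hopMatrix S P t u v := by
  refine Summable.of_nonneg_of_le
    (fun t => mul_nonneg t.cast_nonneg (hopMatrix_nonneg hP t u v)) (fun t => ?_)
    (hasSum_mul_indicator_hopMatrix_indicator hP hrow hsymm hlim).summable
  gcongr
  simp only [mulVec, dotProduct, hopMatrix_mul_indicator, Finset.mul_sum, indicator_mul_hopMatrix]
  calc hopMatrix S P t u v ≤ ∑ w, hopMatrix S P t u w :=
        Finset.single_le_sum (fun w _ => hopMatrix_nonneg hP t u w) (Finset.mem_univ v)
    _ ≤ _ := Finset.single_le_sum (f := fun x => ∑ w, hopMatrix S P t x w)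
        (fun x _ => Finset.sum_nonneg fun w _ => hopMatrix_nonneg hP t x w) (Finset.mem_univ u)

theorem indicator_hopMoment_indicator (hP : ∀ u v, 0 ≤ P u v) (hrow : P *ᵥ 1 = 1)
    (hsymm : Pᵀ = P) (hlim : Tendsto (survival S P) atTop (𝓝 0)) :
    indicatorVec S ⬝ᵥ (hopMoment S P *ᵥ indicatorVec S) = Fintype.card V := by
  refine HasSum.unique ?_ (hasSum_mul_indicator_hopMatrix_indicator hP hrow hsymm hlim)
  simp only [dotProduct, mulVec, Finset.mul_sum]
  refine hasSum_sum fun u _ => hasSum_sum fun v _ => ?_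
  have := ((summable_mul_hopMatrix hP hrow hsymm hlim u v).hasSum.mul_right
    (indicatorVec S v)).mul_left (indicatorVec S u)
  refine this.congr_fun fun t => ?_
  ring

/-- The `i`-th transition length has stationary mean `|V| / |S|`. -/
theorem hasSum_length_mul_pathSum_hopMatrix (hP : ∀ u v, 0 ≤ P u v) (hrow : P *ᵥ 1 = 1)
    (hsymm : Pᵀ = P) (hlim : Tendsto (survival S P) atTop (𝓝 0)) {h : ℕ} (i : Fin h) :
    HasSum (fun ts : Fin h → ℕ => (ts i : ℝ) *
        pathSum (indicatorVec S) (indicatorVec S) fun j => hopMatrix S P (ts j))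
      (Fintype.card V) := by
  rw [← indicator_hopMoment_indicator hP hrow hsymm hlim,
    ← pathSum_single_exception _ _ _ _ (indicator_vecMul_hopTotal hP hrow hsymm hlim)
      (hopTotal_mulVec_indicator hP hrow hlim) i]
  simp only [pathSum, Finset.mul_sum]
  refine hasSum_sum fun s _ => ?_
  have hprod := hasSum_fin_prod
    (fun j t => (if i = j then (t : ℝ) else 1) * hopMatrix S P t (s j.castSucc) (s j.succ))
    (fun j => (if i = j then hopMoment S P else hopTotal S P) (s j.castSucc) (s j.succ))
    (fun j t => mul_nonneg (by split_ifs <;> positivity) (hopMatrix_nonneg hP t _ _))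
    (fun j => by
      by_cases hij : i = j
      · simpa [hij, hopMoment] using (summable_mul_hopMatrix hP hrow hsymm hlim _ _).hasSum
      · simpa [hij, hopTotal] using (summable_hopMatrix hP hrow hlim _ _).hasSum)
  refine ((hprod.mul_left (indicatorVec S (s 0))).mul_right
    (indicatorVec S (s (Fin.last h)))).congr_fun fun ts => ?_
  rw [Finset.prod_mul_distrib, Finset.prod_ite_eq]
  simp only [Finset.mem_univ, if_true]
  ring

end Projected

section LazyWalk

variable {V : Type*} [Fintype V] [DecidableEq V] (G : SimpleGraph V) [DecidableRel G.Adj] (d : ℕ)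

theorem lazyStep_nonneg (hdeg : ∀ v, G.degree v ≤ d) (u v : V) : 0 ≤ lazyStep G d u v := by
  simp only [lazyStep, of_apply]
  split_ifs
  · positivity
  · have : (G.degree u : ℝ) ≤ d := by exact_mod_cast hdeg u
    exact sub_nonneg.2 (div_le_one_of_le₀ (by linarith [G.degree u |>.cast_nonneg (α := ℝ)])
      (by positivity))
  · exact le_rfl

theorem lazyStep_transpose : (lazyStep G d)ᵀ = lazyStep G d := by
  ext u v
  by_cases huv : u = v
  · subst huv; rfl
  · simp [lazyStep, G.adj_comm v u, huv, Ne.symm huv]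

theorem lazyStep_mulVec_one : lazyStep G d *ᵥ 1 = 1 := by
  ext u
  have hsplit (v : V) : lazyStep G d u v = (if G.Adj u v then 1 / (2 * (d : ℝ)) else 0) +
      if u = v then 1 - (G.degree u : ℝ) / (2 * d) else 0 := by
    by_cases huv : u = v
    · subst huv; simp [lazyStep]
    · simp [lazyStep, huv]
  simp only [mulVec, dotProduct, Pi.one_apply, mul_one, hsplit, Finset.sum_add_distrib]
  rw [Finset.sum_ite_eq, ← Finset.sum_filter, Finset.sum_const, ← G.neighborFinset_eq_filter,
    G.card_neighborFinset_eq_degree]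
  simp only [Finset.mem_univ, if_true, nsmul_eq_mul]
  ring

theorem lazyStep_pos_of_adj (hd : 1 ≤ d) (u v : V) (huv : G.Adj u v) : 0 < lazyStep G d u v := by
  have : (0 : ℝ) < d := by exact_mod_cast hd
  simp only [lazyStep, of_apply, if_pos huv]
  positivity

theorem projTrans_succ (S : Finset V) (t : ℕ) (u v : V) :
    projTrans G d S (t + 1) u v = (lazyStep G d * killedStep S (lazyStep G d) ^ t) u v := by
  have hpath : pathSum (Pi.single u 1) (Pi.single v 1)
      (fun j : Fin (t + 1) => if j = 0 then lazyStep G d else killedStep S (lazyStep G d)) =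
      (lazyStep G d * killedStep S (lazyStep G d) ^ t) u v := by
    simp only [pathSum_succ, if_true, Fin.succ_ne_zero, if_false, pathSum_const]
    simp [mul_apply, dotProduct]
  rw [← hpath, projTrans, pathSum]
  refine Finset.sum_congr rfl fun w _ => ?_
  by_cases h0 : w 0 = u
  swap
  · simp [h0]
  by_cases h1 : w (Fin.last (t + 1)) = v
  swap
  · simp [h1]
  simp only [h0, h1, true_and, Pi.single_eq_same, one_mul, mul_one]
  split_ifs with hw
  · refine Finset.prod_congr rfl fun j _ => ?_
    by_cases hj : j = 0
    · simp [hj]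
    · have : w j.castSucc ∉ S := hw _ (by simpa using hj) (Fin.castSucc_ne_last j)
      simp [hj, killedStep, this]
  · push Not at hw
    obtain ⟨i, hi0, hi1, hiS⟩ := hw
    obtain ⟨j, rfl⟩ := Fin.exists_castSucc_eq.2 hi1
    refine (Finset.prod_eq_zero (Finset.mem_univ j) ?_).symm
    have hj : j ≠ 0 := by simpa using hi0
    simp [hj, killedStep, hiS]

theorem hopMatrix_lazyStep (S : Finset V) (t : ℕ) (u v : V) :
    hopMatrix S (lazyStep G d) t u v =
      if u ∈ S ∧ v ∈ S ∧ 1 ≤ t then projTrans G d S t u v else 0 := by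
  cases t with
  | zero => simp [hopMatrix]
  | succ t => simp [hopMatrix, projTrans_succ]

theorem expHopLength_eq_tsum_pathSum (S : Finset V) (h : ℕ) :
    expHopLength G d S h = ∑' ts : Fin h → ℕ, 1 / (S.card : ℝ) * ∑ i, (ts i : ℝ) *
      pathSum (indicatorVec S) (indicatorVec S) fun j => hopMatrix S (lazyStep G d) (ts j) := by
  refine tsum_congr fun ts => ?_
  rw [← Finset.sum_mul, pathSum, Finset.mul_sum, Finset.mul_sum]
  refine Finset.sum_congr rfl fun s _ => ?_
  split_ifs with hs
  · obtain ⟨hs, ht⟩ := hs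
    simp only [hopMatrix_lazyStep, indicatorVec, hs, ht, true_and, if_true]
    ring
  · suffices indicatorVec S (s 0) *
        ∏ j, hopMatrix S (lazyStep G d) (ts j) (s j.castSucc) (s j.succ) = 0 by simp [this]
    rcases not_and_or.1 hs with hs | ht
    · obtain ⟨i, hi⟩ := not_forall.1 hs
      cases i using Fin.cases with
      | zero => simp [indicatorVec, hi]
      | succ j =>
        rw [Finset.prod_eq_zero (Finset.mem_univ j) (by simp [hopMatrix, hi]), mul_zero]
    · obtain ⟨j, hj⟩ := not_forall.1 ht
      rw [Finset.prod_eq_zero (Finset.mem_univ j) (by simp [hopMatrix, hj]), mul_zero]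

end LazyWalk

/-- Kac-type formula: the expected length of an `h`-hop walk in `M_S` started
from the uniform distribution on `S` is `h n / |S|`. -/
theorem expected_hop_length {V : Type} [Fintype V] [DecidableEq V] (G : SimpleGraph V)
    [DecidableRel G.Adj] (d : ℕ) (hd : 1 ≤ d) (hdeg : ∀ v, G.degree v ≤ d)
    (hconn : G.Connected) (S : Finset V) (hS : S.Nonempty) (h : ℕ) (hh : 0 < h) :
    expHopLength G d S h = h * (Fintype.card V : ℝ) / S.card := by
  have hP := lazyStep_nonneg G d hdeg
  have hrow := lazyStep_mulVec_one G d
  have hlim := survival_tendsto_zero hconn hS hP hrow (lazyStep_pos_of_adj G d hd)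
  have hsum := (hasSum_sum fun (i : Fin h) (_ : i ∈ Finset.univ) =>
    hasSum_length_mul_pathSum_hopMatrix hP hrow (lazyStep_transpose G d) hlim i).mul_left
      (1 / (S.card : ℝ))
  rw [expHopLength_eq_tsum_pathSum, hsum.tsum_eq]
  simp only [Finset.sum_const, Finset.card_univ, Fintype.card_fin, nsmul_eq_mul]
  ring
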